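/- Let u,v ∈ ℝ⁴ and let α > 0, β ∈ ℝ satisfy Δ_{32}(u,v)(α,β) = 0 and ρ_v(α,β) ≠ 0. Then Δ_{31}(u,v)(α,β) = 0 if and only if τ_{v,1/3}(α,β) = 0 or Δ_{21}(u,v)(α,β) = 0. (Since at s = 1/3 the partial derivative of Δ_{32}(u,v) with respect to β equals −Δ_{31}(u,v), this says a numerical λ-wall at s = 1/3 is horizontal at a point off Θ_v exactly when the point lies on Γ_{v,1/3} or on the associated numerical ν-wall Ξ_{u,v}.) -/

import Mathlib

noncomputable section

/-- `ρ_v(α,β) = v2 − βv1 + (β²−α²)v0/2`. -/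
def rho (v : Fin 4 → ℝ) (α β : ℝ) : ℝ :=
  v 2 - β * v 1 + (β ^ 2 - α ^ 2) * v 0 / 2

/-- `τ_{v,s}(α,β)`. -/
def tau (v : Fin 4 → ℝ) (s α β : ℝ) : ℝ :=
  v 3 - β * v 2 + β ^ 2 / 2 * v 1 - β ^ 3 / 6 * v 0 - (s + 1 / 6) * (v 1 - β * v 0) * α ^ 2

/-- The twisted Chern character `ch^{α,β}(v)` (with `ch₃^{α,β} = τ_{v,1/3}`). -/
def chab (v : Fin 4 → ℝ) (α β : ℝ) : Fin 4 → ℝ :=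
  ![v 0, v 1 - β * v 0, rho v α β, tau v (1 / 3) α β]

/-- `Δ_{ij}(u,v)(α,β) = ch_i^{α,β}(u)ch_j^{α,β}(v) − ch_j^{α,β}(u)ch_i^{α,β}(v)`. -/
def Dlt (u v : Fin 4 → ℝ) (α β : ℝ) (i j : Fin 4) : ℝ :=
  chab u α β i * chab v α β j - chab u α β j * chab v α β i

/-- At a point of the numerical λ-wall at `s = 1/3` lying off `Θ_v`, the wall is horizontal
(`Δ₃₁ = 0`) exactly when the point lies on `Γ_{v,1/3}` or on the numerical ν-wall `Ξ_{u,v}`. -/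
theorem lambda_wall_horizontal_iff
    (u v : Fin 4 → ℝ) (α β : ℝ) (hα : 0 < α)
    (hwall : Dlt u v α β 3 2 = 0) (hρ : rho v α β ≠ 0) :
    Dlt u v α β 3 1 = 0 ↔ tau v (1 / 3) α β = 0 ∨ Dlt u v α β 2 1 = 0 := by
  have key : Dlt u v α β 3 1 * rho v α β = tau v (1 / 3) α β * Dlt u v α β 2 1 := by
    simp only [Dlt, chab, Matrix.cons_val] at hwall ⊢
    linear_combination (v 1 - β * v 0) * hwall
  rw [← mul_eq_zero, ← key, mul_eq_zero, or_iff_left hρ]
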